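/- arXiv:2603.07042 — 2 statements merged into one kernel-verified Lean document; each statement's English description precedes it below -/
import Mathlib

section
/- Let X be a complete real normed vector space, let u : ℝ → X be continuously differentiable on [0,∞), let ψ ∈ X, let θ ∈ (0, 1/2), σ > 0, c > 0, and let H : ℝ → ℝ be differentiable and nonincreasing on [0,∞) with H(t) ≥ 0 for all t ≥ 0. Assume: (i) −H'(t) ≥ c·‖u'(t)‖² for all t ≥ 0; (ii) −H'(t) ≥ H(t)^{1−θ}·‖u'(t)‖ for every t ≥ 0 with ‖u(t) − ψ‖ < σ; (iii) there is a sequence t_n → ∞ with ‖u(t_n) − ψ‖ → 0 and H(t_n) → 0. Then ∫_0^∞ ‖u'(τ)‖ dτ < ∞ and u(t) → ψ as t → ∞. -/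
open Real MeasureTheory Filter Topology

/-- A curve whose speed is bounded by the dissipation rate `-Φ'` while it stays in a ball never
leaves this ball, if it starts with a margin larger than the initial value of `Φ`. -/
theorem norm_sub_lt_of_norm_deriv_le_neg_deriv {X : Type*} [NormedAddCommGroup X]
    [NormedSpace ℝ X] {u u' : ℝ → X} {Φ Φ' : ℝ → ℝ} {ψ : X} {σ a : ℝ}
    (hu : ∀ t ≥ a, HasDerivWithinAt u (u' t) (Set.Ici a) t)
    (hΦ : ∀ t ≥ a, HasDerivWithinAt Φ (Φ' t) (Set.Ici a) t)
    (hΦ0 : ∀ t ≥ a, 0 ≤ Φ t)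
    (hle : ∀ t ≥ a, ‖u t - ψ‖ < σ → ‖u' t‖ ≤ -Φ' t)
    (ha : ‖u a - ψ‖ + Φ a < σ) {b : ℝ} (hab : a ≤ b) : ‖u b - ψ‖ < σ := by
  obtain ⟨ε, hε, hεb⟩ := exists_pos_mul_lt (sub_pos.2 ha) (b - a)
  have hball : ∀ t ∈ Set.Icc a b, ‖u t - u a‖ ≤ Φ a - Φ t + ε * (t - a) →
      ‖u t - ψ‖ < σ := by
    intro t ht h
    have hεt : ε * (t - a) ≤ ε * (b - a) := by gcongr; exact ht.2
    have htri : ‖u t - ψ‖ ≤ ‖u t - u a‖ + ‖u a - ψ‖ := norm_sub_le_norm_sub_add_norm_sub _ _ _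
    linarith [hΦ0 t ht.1]
  refine hball b ⟨hab, le_rfl⟩ ?_
  have hB : ∀ t ≥ a, HasDerivWithinAt (fun t => Φ a - Φ t + ε * (t - a)) (-Φ' t + ε)
      (Set.Ici a) t := by
    intro t ht
    have hlin : HasDerivWithinAt (fun t => ε * (t - a)) ε (Set.Ici a) t := by
      simpa using (((hasDerivAt_id t).sub_const a).const_mul ε).hasDerivWithinAt
    exact ((hΦ t ht).const_sub (Φ a)).add hlin
  refine image_norm_le_of_norm_deriv_right_lt_deriv_boundary' (a := a) (b := b)
    (f := fun t => u t - u a) (f' := u') (B := fun t => Φ a - Φ t + ε * (t - a))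
    (B' := fun t => -Φ' t + ε) ?_ ?_ ?_ ?_ ?_ ?_ ⟨hab, le_rfl⟩
  · exact fun t ht => (((hu t ht.1).sub_const _).continuousWithinAt).mono Set.Icc_subset_Ici_self
  · exact fun t ht => ((hu t ht.1).sub_const _).mono (Set.Ici_subset_Ici.2 ht.1)
  · simp
  · exact fun t ht => (hB t ht.1).continuousWithinAt.mono Set.Icc_subset_Ici_self
  · exact fun t ht => (hB t ht.1).mono (Set.Ici_subset_Ici.2 ht.1)
  · intro t ht h
    have := hle t ht.1 (hball t ⟨ht.1, ht.2.le⟩ h.le)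
    linarith

/-- A continuous function dominated by the dissipation rate of a nonnegative quantity is
integrable. -/
theorem integrableOn_Ioi_of_norm_le_neg_deriv {X : Type*} [NormedAddCommGroup X]
    {v : ℝ → X} {Φ Φ' : ℝ → ℝ} {a : ℝ} (hv : ContinuousOn v (Set.Ici a))
    (hΦ : ∀ t ≥ a, HasDerivWithinAt Φ (Φ' t) (Set.Ici a) t)
    (hΦ0 : ∀ t ≥ a, 0 ≤ Φ t) (hle : ∀ t ≥ a, ‖v t‖ ≤ -Φ' t) :
    IntegrableOn v (Set.Ioi a) := by
  have hint : ∀ b, IntegrableOn v (Set.Icc a b) := fun b =>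
    (hv.mono Set.Icc_subset_Ici_self).integrableOn_Icc
  refine integrableOn_Ioi_of_intervalIntegral_norm_bounded (Φ a) a (l := atTop) (b := id)
    (fun b => (hint b).mono_set Set.Ioc_subset_Icc_self) tendsto_id ?_
  filter_upwards [eventually_ge_atTop a] with b hb
  have h := intervalIntegral.integral_le_sub_of_hasDeriv_right_of_le (g := fun t => -Φ t)
    (g' := fun t => -Φ' t) (φ := fun t => ‖v t‖) hb
    (fun t ht => (hΦ t ht.1).neg.continuousWithinAt.mono Set.Icc_subset_Ici_self)
    (fun t ht => (hΦ t ht.1.le).neg.mono (Set.Ioi_subset_Ici ht.1.le))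
    (hint b).norm (fun t ht => hle t ht.1.le)
  have := hΦ0 b hb
  simp only [id]
  linarith

/-- Abstract Lojasiewicz–Simon trapping argument: under the stated hypotheses on the
energy gap H and the trajectory u, the trajectory has finite length and converges
to the equilibrium ψ. -/
theorem stmt_8 {X : Type*} [NormedAddCommGroup X] [NormedSpace ℝ X] [CompleteSpace X]
    (u u' : ℝ → X) (ψ : X) (θ σ c : ℝ)
    (hθ0 : 0 < θ) (hθ : θ < 1 / 2) (hσ : 0 < σ) (hc : 0 < c)
    (hu : ∀ t ≥ (0 : ℝ), HasDerivWithinAt u (u' t) (Set.Ici 0) t)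
    (hu' : ContinuousOn u' (Set.Ici 0))
    (H H' : ℝ → ℝ)
    (hH : ∀ t ≥ (0 : ℝ), HasDerivWithinAt H (H' t) (Set.Ici 0) t)
    (hHanti : AntitoneOn H (Set.Ici 0))
    (hHnonneg : ∀ t ≥ (0 : ℝ), 0 ≤ H t)
    (h1 : ∀ t ≥ (0 : ℝ), c * ‖u' t‖ ^ 2 ≤ -H' t)
    (h2 : ∀ t ≥ (0 : ℝ), ‖u t - ψ‖ < σ → H t ^ (1 - θ) * ‖u' t‖ ≤ -H' t)
    (tseq : ℕ → ℝ) (htseq0 : ∀ n, 0 ≤ tseq n)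
    (htseq : Filter.Tendsto tseq Filter.atTop Filter.atTop)
    (hconv : Filter.Tendsto (fun n => ‖u (tseq n) - ψ‖) Filter.atTop (nhds 0))
    (hHconv : Filter.Tendsto (fun n => H (tseq n)) Filter.atTop (nhds 0)) :
    IntegrableOn (fun τ => ‖u' τ‖) (Set.Ici 0) volume ∧
      Filter.Tendsto u Filter.atTop (nhds ψ) := by
  have hcont_pow : Tendsto (fun n => θ⁻¹ * H (tseq n) ^ θ) atTop (𝓝 0) := by
    simpa [Real.zero_rpow hθ0.ne'] using
      (hHconv.rpow_const (p := θ) (Or.inr hθ0.le)).const_mul θ⁻¹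
  have htail : ∃ a ≥ (0 : ℝ), IntegrableOn u' (Set.Ioi a) := by
    by_cases hzero : ∃ T ≥ (0 : ℝ), H T = 0
    · obtain ⟨T, hT, hHT⟩ := hzero
      refine ⟨T, hT, integrableOn_zero.congr_fun (fun t ht => ?_) measurableSet_Ioi⟩
      have ht0 : 0 ≤ t := hT.trans (le_of_lt ht)
      have hH0 : ∀ s ∈ Set.Ici t, H s = 0 := fun s hs =>
        le_antisymm (hHT ▸ hHanti hT (ht0.trans hs) ((le_of_lt ht).trans hs))
          (hHnonneg s (ht0.trans hs))
      have hH't : H' t = 0 :=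
        (uniqueDiffOn_Ici t t Set.self_mem_Ici).eq_deriv _
          ((hH t ht0).mono (Set.Ici_subset_Ici.2 ht0))
          ((hasDerivWithinAt_const t _ (0 : ℝ)).congr hH0 (hH0 t Set.self_mem_Ici))
      have hsq : ‖u' t‖ ^ 2 ≤ 0 := by
        have := h1 t ht0
        rw [hH't, neg_zero] at this
        exact nonpos_of_mul_nonpos_right this hc
      have : ‖u' t‖ = 0 := pow_eq_zero_iff two_ne_zero |>.1 (le_antisymm hsq (sq_nonneg _))
      exact (norm_eq_zero.1 this).symm
    · push Not at hzero
      have hpos : ∀ t ≥ (0 : ℝ), 0 < H t := fun t ht =>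
        (hHnonneg t ht).lt_of_ne' (hzero t ht)
      have hsum : Tendsto (fun n => ‖u (tseq n) - ψ‖ + θ⁻¹ * H (tseq n) ^ θ) atTop (𝓝 0) := by
        simpa using hconv.add hcont_pow
      obtain ⟨n, hn⟩ := (hsum.eventually_lt_const hσ).exists
      have ha := htseq0 n
      generalize tseq n = a at hn ha
      have hsub : Set.Ici a ⊆ Set.Ici 0 := Set.Ici_subset_Ici.2 ha
      have hΦ : ∀ t ≥ a, HasDerivWithinAt (fun t => θ⁻¹ * H t ^ θ) (H t ^ (θ - 1) * H' t)
          (Set.Ici a) t := by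
        intro t ht
        have h := (((hH t (ha.trans ht)).mono hsub).rpow_const (p := θ)
          (Or.inl (hpos t (ha.trans ht)).ne')).const_mul θ⁻¹
        exact h.congr_deriv (by field_simp)
      have hΦ0 : ∀ t ≥ a, 0 ≤ θ⁻¹ * H t ^ θ := fun t ht =>
        mul_nonneg (inv_nonneg.2 hθ0.le) (Real.rpow_nonneg (hHnonneg t (ha.trans ht)) _)
      have hle : ∀ t ≥ a, ‖u t - ψ‖ < σ → ‖u' t‖ ≤ -(H t ^ (θ - 1) * H' t) := by
        intro t ht hball
        have hHt := hpos t (ha.trans ht)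
        calc ‖u' t‖ = H t ^ (θ - 1) * (H t ^ (1 - θ) * ‖u' t‖) := by
              rw [← mul_assoc, ← Real.rpow_add hHt]; simp
          _ ≤ H t ^ (θ - 1) * -H' t :=
              mul_le_mul_of_nonneg_left (h2 t (ha.trans ht) hball) (Real.rpow_nonneg hHt.le _)
          _ = -(H t ^ (θ - 1) * H' t) := mul_neg _ _
      refine ⟨a, ha, integrableOn_Ioi_of_norm_le_neg_deriv (hu'.mono hsub) hΦ hΦ0
        fun t ht => hle t ht ?_⟩
      exact norm_sub_lt_of_norm_deriv_le_neg_deriv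
        (fun t ht => (hu t (ha.trans ht)).mono hsub) hΦ hΦ0 hle hn ht
  obtain ⟨a, ha, hint⟩ := htail
  have hint0 : IntegrableOn u' (Set.Ici 0) := by
    rw [← Set.Icc_union_Ioi_eq_Ici ha]
    exact (hu'.mono Set.Icc_subset_Ici_self).integrableOn_Icc.union hint
  have hlim := tendsto_limUnder_of_hasDerivAt_of_integrableOn_Ioi
    (fun t (ht : t ∈ Set.Ioi (0 : ℝ)) => (hu t (le_of_lt ht)).hasDerivAt (Ici_mem_nhds ht))
    (hint0.mono_set Set.Ioi_subset_Ici_self)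
  have heq := tendsto_nhds_unique (hlim.comp htseq) (tendsto_iff_norm_sub_tendsto_zero.2 hconv)
  exact ⟨hint0.norm, heq ▸ hlim⟩
end

section
/- Let X be a complete real normed vector space, let T > 0, γ > 1, C > 0 and M > 0 be real numbers, let u : ℝ → X be continuously differentiable on [T,∞), let ψ ∈ X with u(t) → ψ as t → ∞, and let G : ℝ → ℝ be differentiable and nonincreasing on [T,∞) with G(t) ≥ 0, ‖u'(t)‖² ≤ −C·G'(t), and G(t) ≤ M·t^{−γ} for all t ≥ T. Then for every t ≥ T, ‖u(t) − ψ‖ ≤ √(C·M) · (1 − 2^{(1−γ)/2})^{−1} · t^{(1−γ)/2}. -/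
open Real

/-- If `‖u'‖² ≤ -C * G'` then the increment of `u` over `[a, b]` is controlled by a weighted
arithmetic mean of the length `b - a` and of `C * (G a - G b)`, for every weight `c > 0`. -/
lemma norm_sub_le_of_sq_norm_deriv_le {X : Type*} [NormedAddCommGroup X] [NormedSpace ℝ X]
    {T C a b c : ℝ} (hTa : T ≤ a) (hab : a ≤ b) (hc : 0 < c) {u u' : ℝ → X} {G G' : ℝ → ℝ}
    (hu : ∀ t ≥ T, HasDerivWithinAt u (u' t) (Set.Ici T) t)
    (hG : ∀ t ≥ T, HasDerivWithinAt G (G' t) (Set.Ici T) t)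
    (hineq : ∀ t ≥ T, ‖u' t‖ ^ 2 ≤ -C * G' t) :
    ‖u b - u a‖ ≤ (c * (b - a) + C * (G a - G b) / c) / 2 := by
  have hf : ∀ t ≥ T, HasDerivWithinAt (fun x => u x - u a) (u' t) (Set.Ici T) t :=
    fun t ht => (hu t ht).sub_const _
  have hB : ∀ t ≥ T, HasDerivWithinAt (fun x => (c * (x - a) + C * (G a - G x) / c) / 2)
      ((c * 1 + C * (-G' t) / c) / 2) (Set.Ici T) t := fun t ht =>
    ((((hasDerivWithinAt_id t _).sub_const a).const_mul c).add
      ((((hG t ht).const_sub (G a)).const_mul C).div_const c)).div_const 2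
  have hsub : Set.Icc a b ⊆ Set.Ici T := fun x hx => hTa.trans hx.1
  refine image_norm_le_of_norm_deriv_right_le_deriv_boundary'
    (f := fun x => u x - u a) (f' := u')
    (B := fun x => (c * (x - a) + C * (G a - G x) / c) / 2)
    (B' := fun t => (c * 1 + C * (-G' t) / c) / 2)
    (fun x hx => ((hf x (hsub hx)).continuousWithinAt.mono hsub))
    (fun x hx => (hf x (hTa.trans hx.1)).mono (Set.Ici_subset_Ici.2 (hTa.trans hx.1)))
    (by simp)
    (fun x hx => ((hB x (hsub hx)).continuousWithinAt.mono hsub))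
    (fun x hx => (hB x (hTa.trans hx.1)).mono (Set.Ici_subset_Ici.2 (hTa.trans hx.1)))
    (fun x hx => ?_) (Set.right_mem_Icc.2 hab)
  have h := hineq x (hTa.trans hx.1)
  have h1 : (2 * ‖u' x‖ - c) * c ≤ C * (-G' x) := by nlinarith [sq_nonneg (‖u' x‖ - c)]
  have h2 := (le_div_iff₀ hc).2 h1
  linarith

/-- Under the decay `G t ≤ M * t ^ (-γ)`, the increment of `u` over a dyadic block `[a, 2a]` is at
most `√(C * M) * a ^ ((1 - γ) / 2)`. -/
lemma norm_sub_le_of_decay {X : Type*} [NormedAddCommGroup X] [NormedSpace ℝ X]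
    {T γ C M a : ℝ} (hT : 0 < T) (hC : 0 < C) (hM : 0 < M) (hTa : T ≤ a)
    {u u' : ℝ → X} {G G' : ℝ → ℝ}
    (hu : ∀ t ≥ T, HasDerivWithinAt u (u' t) (Set.Ici T) t)
    (hG : ∀ t ≥ T, HasDerivWithinAt G (G' t) (Set.Ici T) t)
    (hGnonneg : ∀ t ≥ T, 0 ≤ G t)
    (hineq : ∀ t ≥ T, ‖u' t‖ ^ 2 ≤ -C * G' t)
    (hdecay : ∀ t ≥ T, G t ≤ M * t ^ (-γ)) :
    ‖u (2 * a) - u a‖ ≤ √(C * M) * a ^ ((1 - γ) / 2) := by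
  have ha : 0 < a := hT.trans_le hTa
  have hK : 0 < √(C * M) := Real.sqrt_pos.2 (mul_pos hC hM)
  have hp : 0 < a ^ ((1 - γ) / 2) := rpow_pos_of_pos ha _
  have hKp := mul_pos hK hp
  have hpow : a ^ (-γ) * a = a ^ ((1 - γ) / 2) * a ^ ((1 - γ) / 2) := by
    rw [← rpow_add ha, ← rpow_add_one ha.ne']
    ring_nf
  have h := norm_sub_le_of_sq_norm_deriv_le (b := 2 * a) hTa (by linarith) (div_pos hKp ha)
    hu hG hineq
  have hGle : C * (G a - G (2 * a)) ≤ C * (M * a ^ (-γ)) := by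
    have h1 := hdecay a hTa
    have h2 := hGnonneg (2 * a) (by linarith)
    gcongr
    linarith
  have hquot : C * (G a - G (2 * a)) / (√(C * M) * a ^ ((1 - γ) / 2) / a)
      ≤ √(C * M) * a ^ ((1 - γ) / 2) := by
    rw [div_le_iff₀ (div_pos hKp ha), ← mul_div_assoc, le_div_iff₀ ha]
    calc C * (G a - G (2 * a)) * a ≤ C * (M * a ^ (-γ)) * a := by gcongr
      _ = C * M * (a ^ (-γ) * a) := by ring
      _ = √(C * M) * √(C * M) * (a ^ ((1 - γ) / 2) * a ^ ((1 - γ) / 2)) := by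
        rw [hpow, Real.mul_self_sqrt (mul_pos hC hM).le]
      _ = _ := by ring
  have hlin : √(C * M) * a ^ ((1 - γ) / 2) / a * (2 * a - a) = √(C * M) * a ^ ((1 - γ) / 2) := by
    field_simp
    ring
  linarith


/-- Abstract convergence-rate theorem: if u is C¹ on [T,∞) with limit ψ, G is a
nonincreasing nonnegative differentiable function on [T,∞) with ‖u'(t)‖² ≤ −C G'(t)
and G(t) ≤ M t^{−γ} there (γ > 1), then
‖u(t) − ψ‖ ≤ √(CM) (1 − 2^{(1−γ)/2})⁻¹ t^{(1−γ)/2} for all t ≥ T. -/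
theorem stmt_9 {X : Type*} [NormedAddCommGroup X] [NormedSpace ℝ X] [CompleteSpace X]
    (T γ C M : ℝ) (hT : 0 < T) (hγ : 1 < γ) (hC : 0 < C) (hM : 0 < M)
    (u u' : ℝ → X) (ψ : X)
    (hu : ∀ t ≥ T, HasDerivWithinAt u (u' t) (Set.Ici T) t)
    (hu' : ContinuousOn u' (Set.Ici T))
    (hlim : Filter.Tendsto u Filter.atTop (nhds ψ))
    (G G' : ℝ → ℝ)
    (hG : ∀ t ≥ T, HasDerivWithinAt G (G' t) (Set.Ici T) t)
    (hGanti : AntitoneOn G (Set.Ici T))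
    (hGnonneg : ∀ t ≥ T, 0 ≤ G t)
    (hineq : ∀ t ≥ T, ‖u' t‖ ^ 2 ≤ -C * G' t)
    (hdecay : ∀ t ≥ T, G t ≤ M * t ^ (-γ)) :
    ∀ t ≥ T, ‖u t - ψ‖ ≤
      Real.sqrt (C * M) * (1 - (2 : ℝ) ^ ((1 - γ) / 2))⁻¹ * t ^ ((1 - γ) / 2) := by
  intro t ht
  have ht0 : 0 < t := hT.trans_le ht
  have hr : (2 : ℝ) ^ ((1 - γ) / 2) < 1 :=
    rpow_lt_one_of_one_lt_of_neg one_lt_two (by linarith)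
  have htend : Filter.Tendsto (fun n : ℕ => (2 : ℝ) ^ n * t) Filter.atTop Filter.atTop :=
    (tendsto_pow_atTop_atTop_of_one_lt one_lt_two).atTop_mul_const ht0
  have hstep : ∀ n : ℕ, dist (u (2 ^ n * t)) (u (2 ^ (n + 1) * t)) ≤
      √(C * M) * t ^ ((1 - γ) / 2) * ((2 : ℝ) ^ ((1 - γ) / 2)) ^ n := by
    intro n
    have hle : T ≤ 2 ^ n * t :=
      ht.trans (le_mul_of_one_le_left ht0.le (one_le_pow₀ one_le_two))
    have h := norm_sub_le_of_decay hT hC hM hle hu hG hGnonneg hineq hdecay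
    rw [mul_rpow (by positivity) ht0.le, ← rpow_pow_comm zero_le_two] at h
    rw [dist_comm, dist_eq_norm, pow_succ', mul_assoc 2]
    exact h.trans_eq (by ring)
  have h := dist_le_of_le_geometric_of_tendsto₀ _ _ hr hstep (hlim.comp htend)
  simp only [pow_zero, one_mul, dist_eq_norm] at h
  exact h.trans_eq (by ring)
end
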